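/- Let X and T be independent nonnegative real-valued random variables on a probability space, where X is exponentially distributed with rate λ1 > 0 and T is integrable. Then E[(T − X)·X·1_{X ≤ T}] = E[T]/λ1 + E[T·exp(−λ1·T)]/λ1 + 2·E[exp(−λ1·T)]/λ1² − 2/λ1². -/

import Mathlib

open MeasureTheory ProbabilityTheory Real

lemma toReal_exponentialPDF {r : ℝ} (hr : 0 < r) (x : ℝ) :
    (exponentialPDF r x).toReal = (Set.Ici 0).indicator (fun y ↦ r * exp (-(r * y))) x := by
  rw [exponentialPDF_eq, ENNReal.toReal_ofReal (by split_ifs <;> positivity)]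
  simp [Set.indicator_apply]

lemma expMeasure_eq_withDensity (r : ℝ) :
    expMeasure r = volume.withDensity (exponentialPDF r) := rfl

lemma measurable_exponentialPDF (r : ℝ) : Measurable (exponentialPDF r) :=
  (measurable_exponentialPDFReal r).ennreal_ofReal

lemma integral_expMeasure {r : ℝ} (hr : 0 < r) (f : ℝ → ℝ) :
    ∫ x, f x ∂expMeasure r = ∫ x in Set.Ioi 0, r * exp (-(r * x)) * f x := by
  rw [expMeasure_eq_withDensity, integral_withDensity_eq_integral_toReal_smul
    (measurable_exponentialPDF r) (ae_of_all _ fun _ ↦ ENNReal.ofReal_lt_top),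
    ← integral_Ici_eq_integral_Ioi, ← integral_indicator measurableSet_Ici]
  congr 1 with x
  rw [toReal_exponentialPDF hr, smul_eq_mul]
  simp only [Set.indicator_apply, ite_mul, zero_mul]

lemma integrable_id_expMeasure {r : ℝ} (hr : 0 < r) :
    Integrable (fun x ↦ x) (expMeasure r) := by
  rw [expMeasure_eq_withDensity, integrable_withDensity_iff
    (measurable_exponentialPDF r) (ae_of_all _ fun _ ↦ ENNReal.ofReal_lt_top)]
  have h := integrableOn_rpow_mul_exp_neg_mul_rpow (p := 1) (s := 1) (by norm_num) one_pos hr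
  simp only [rpow_one] at h
  have h' : IntegrableOn (fun x ↦ r * (x * exp (-r * x))) (Set.Ici 0) :=
    ((integrableOn_Ici_iff_integrableOn_Ioi).2 h).const_mul r
  refine ((integrable_indicator_iff measurableSet_Ici).2 h').congr (ae_of_all _ fun x ↦ ?_)
  simp only [toReal_exponentialPDF hr, Set.indicator_apply, mul_ite, mul_zero]
  split_ifs
  · rw [neg_mul]; ring
  · rfl

lemma intervalIntegral_exp_mul_sub_mul {r : ℝ} (hr : r ≠ 0) (t : ℝ) :
    ∫ x in 0..t, r * exp (-(r * x)) * ((t - x) * x) =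
      t / r + t * exp (-r * t) / r + 2 * exp (-r * t) / r ^ 2 - 2 / r ^ 2 := by
  have hd : ∀ x ∈ Set.uIcc 0 t, HasDerivAt
      (fun x ↦ (-((t - x) * x) - (t - 2 * x) / r + 2 / r ^ 2) * exp (-(r * x)))
      (r * exp (-(r * x)) * ((t - x) * x)) x := by
    intro x _
    have he : HasDerivAt (fun x ↦ exp (-(r * x))) (exp (-(r * x)) * -(r * 1)) x :=
      ((hasDerivAt_id x).const_mul r).neg.exp
    have hs := (hasDerivAt_id x).const_sub t
    have hp := (((hs.mul (hasDerivAt_id x)).neg.sub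
      ((((hasDerivAt_id x).const_mul 2).const_sub t).div_const r)).add_const (2 / r ^ 2)).mul he
    refine hp.congr_deriv ?_
    simp only [id, Pi.mul_apply, Pi.sub_apply, Pi.neg_apply]
    field_simp
    ring
  rw [intervalIntegral.integral_eq_sub_of_hasDerivAt hd
    (Continuous.intervalIntegrable (by fun_prop) _ _)]
  simp only [mul_zero, neg_zero, exp_zero, neg_mul]
  field_simp
  ring

lemma integral_expMeasure_indicator_sub_mul {r : ℝ} (hr : 0 < r) {t : ℝ} (ht : 0 ≤ t) :
    ∫ x, (if x ≤ t then (t - x) * x else 0) ∂expMeasure r =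
      t / r + t * exp (-r * t) / r + 2 * exp (-r * t) / r ^ 2 - 2 / r ^ 2 := by
  rw [integral_expMeasure hr, ← intervalIntegral_exp_mul_sub_mul hr.ne',
    intervalIntegral.integral_of_le ht, ← Set.Ioi_inter_Iic,
    ← setIntegral_indicator measurableSet_Iic]
  congr 1 with x
  simp only [Set.indicator_apply, Set.mem_Iic, mul_ite, mul_zero]

/-- Equation (mnb50): `E[(T − X)·X·1_{X ≤ T}] = E[T]/λ1 + E[T·e^{−λ1 T}]/λ1
+ 2·E[e^{−λ1 T}]/λ1² − 2/λ1²` for independent nonnegative `X ~ Exp(λ1)` and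
integrable `T`. -/
theorem expectation_residual_times_X_brief_event
    {Ω : Type*} [MeasureSpace Ω] [IsProbabilityMeasure (ℙ : Measure Ω)]
    (l1 : ℝ) (hl1 : 0 < l1) (X T : Ω → ℝ)
    (hXm : Measurable X) (hTm : Measurable T)
    (hXnonneg : ∀ ω, 0 ≤ X ω) (hTnonneg : ∀ ω, 0 ≤ T ω)
    (hindep : IndepFun X T ℙ)
    (hX : Measure.map X ℙ = expMeasure l1)
    (hTint : Integrable T ℙ) :
    (∫ ω in {ω | X ω ≤ T ω}, (T ω - X ω) * X ω ∂ℙ) =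
      (∫ ω, T ω ∂ℙ) / l1 + (∫ ω, T ω * Real.exp (-l1 * T ω) ∂ℙ) / l1
        + 2 * (∫ ω, Real.exp (-l1 * T ω) ∂ℙ) / l1 ^ 2 - 2 / l1 ^ 2 := by
  have hprob : IsProbabilityMeasure (expMeasure l1) := isProbabilityMeasure_expMeasure hl1
  have hTprob : IsProbabilityMeasure (Measure.map T ℙ) :=
    Measure.isProbabilityMeasure_map hTm.aemeasurable
  let f : ℝ × ℝ → ℝ := fun p ↦ if p.1 ≤ p.2 then (p.2 - p.1) * p.1 else 0
  have hf : Measurable f :=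
    Measurable.ite (measurableSet_le measurable_fst measurable_snd) (by fun_prop) measurable_const
  have hXint : Integrable X ℙ := by
    have h := integrable_id_expMeasure hl1
    rw [← hX] at h
    exact h.comp_measurable hXm
  have hfint : Integrable (fun ω ↦ f (X ω, T ω)) ℙ := by
    refine (hindep.integrable_mul hXint hTint).mono
      (hf.comp (hXm.prodMk hTm)).aestronglyMeasurable (ae_of_all _ fun ω ↦ ?_)
    have hx := hXnonneg ω
    have ht := hTnonneg ω
    simp only [f, Pi.mul_apply, norm_eq_abs]
    split_ifs with h
    · rw [abs_of_nonneg (mul_nonneg (sub_nonneg.2 h) hx), abs_of_nonneg (mul_nonneg hx ht)]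
      nlinarith
    · rw [abs_zero]
      positivity
  have hmap : Measure.map (fun ω ↦ (X ω, T ω)) ℙ = (expMeasure l1).prod (Measure.map T ℙ) := by
    rw [← hX]
    exact hindep.map_prod_eq_prod_map_map hXm.aemeasurable hTm.aemeasurable
  have hfprod : Integrable f ((expMeasure l1).prod (Measure.map T ℙ)) := by
    rw [← hmap]
    exact (integrable_map_measure hf.aestronglyMeasurable (hXm.prodMk hTm).aemeasurable).2 hfint
  have hle : ∀ ω, exp (-l1 * T ω) ≤ 1 := fun ω ↦
    exp_le_one_iff.2 (by nlinarith [hTnonneg ω])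
  have hexp : Integrable (fun ω ↦ exp (-l1 * T ω)) ℙ :=
    Integrable.of_bound (by fun_prop) 1
      (ae_of_all _ fun ω ↦ by rw [norm_eq_abs, abs_exp]; exact hle ω)
  have hTexp : Integrable (fun ω ↦ T ω * exp (-l1 * T ω)) ℙ :=
    hTint.mul_bdd (c := 1) (by fun_prop)
      (ae_of_all _ fun ω ↦ by rw [norm_eq_abs, abs_exp]; exact hle ω)
  calc ∫ ω in {ω | X ω ≤ T ω}, (T ω - X ω) * X ω ∂ℙ
      = ∫ ω, f (X ω, T ω) ∂ℙ := by
        rw [← integral_indicator (measurableSet_le hXm hTm)]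
        simp only [f, Set.indicator_apply, Set.mem_ofPred_eq]
    _ = ∫ t, ∫ x, f (x, t) ∂expMeasure l1 ∂Measure.map T ℙ := by
        rw [← integral_prod_symm f hfprod, ← hmap,
          integral_map (hXm.prodMk hTm).aemeasurable hf.aestronglyMeasurable]
    _ = ∫ ω, ∫ x, f (x, T ω) ∂expMeasure l1 ∂ℙ :=
        integral_map hTm.aemeasurable
          hfprod.swap.aestronglyMeasurable.integral_prod_right'
    _ = ∫ ω, (T ω / l1 + T ω * exp (-l1 * T ω) / l1 + 2 * exp (-l1 * T ω) / l1 ^ 2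
          - 2 / l1 ^ 2) ∂ℙ := by
        congr 1 with ω
        exact integral_expMeasure_indicator_sub_mul hl1 (hTnonneg ω)
    _ = _ := by
        have h1 := hTint.div_const l1
        have h2 := hTexp.div_const l1
        have h3 := (hexp.const_mul 2).div_const (l1 ^ 2)
        have h12 : Integrable (fun ω ↦ T ω / l1 + T ω * exp (-l1 * T ω) / l1) ℙ := h1.add h2
        have h123 : Integrable (fun ω ↦ T ω / l1 + T ω * exp (-l1 * T ω) / l1
          + 2 * exp (-l1 * T ω) / l1 ^ 2) ℙ := h12.add h3
        rw [integral_sub h123 (integrable_const _), integral_add h12 h3,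
          integral_add h1 h2]
        simp only [integral_div, integral_const_mul, integral_const, probReal_univ, one_smul]
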